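/- Let K have characteristic zero, X, F vector spaces, ξ, η ∈ S(X) formal series and f ∈ F[[X]]. Then the derivative of f along the bracket [ξ,η] = ξη − ηξ satisfies [ξ,η]f = ξ(ηf) − η(ξf); i.e., the derivation-of-formal-series action makes F[[X]] a module over the Lie algebra S(X). -/

import Mathlib

open Finset
open scoped Nat

/-- `f : E → F` is a homogeneous polynomial of degree `m` with variables in `E`
and coefficients in `F`: it is determined by some `m`-multilinear map. -/
def IsHomog (K : Type*) [Field K] {E F : Type*} [AddCommGroup E] [Module K E]
    [AddCommGroup F] [Module K F] (m : ℕ) (f : E → F) : Prop :=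
  ∃ u : MultilinearMap K (fun _ : Fin m => E) F, ∀ x, f x = u fun _ => x

/-- A formal series with variables in `X` and coefficients in `F`, presented by a
family of multilinear maps determining its homogeneous components. -/
abbrev MSeries (K : Type*) [Field K] (X F : Type*) [AddCommGroup X] [Module K X]
    [AddCommGroup F] [Module K F] :=
  ∀ m : ℕ, MultilinearMap K (fun _ : Fin m => X) F

/-- The homogeneous components (as functions) of a presented formal series. -/
def evalS {K : Type*} [Field K] {X F : Type*} [AddCommGroup X] [Module K X]
    [AddCommGroup F] [Module K F] (f : MSeries K X F) : ℕ → X → F :=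
  fun m x => f m fun _ => x

/-- Degree-`s` component of the derivative `ξ f` of the formal series `f` along the
formal series `ξ` : `g_s = Σ_{r+m-1=s} ξ_r f_m`, where `(ξ_r f_m)(x)` is the sum over
insertions of `ξ_r(x)` into one slot of a multilinear map determining `f_m`. -/
def dcomp {K : Type*} [Field K] {X F : Type*} [AddCommGroup X] [Module K X]
    [AddCommGroup F] [Module K F]
    (ξ : MSeries K X X) (f : MSeries K X F) (s : ℕ) (x : X) : F :=
  ∑ r ∈ Finset.range (s + 2), ∑ i : Fin (s + 1 - r),
    f (s + 1 - r) (Function.update (fun _ => x) i (ξ r fun _ => x))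

/-- The bracket `[ξ,η] = ξη - ηξ` on `S(X)`, at the level of components. -/
def br {K : Type*} [Field K] {X : Type*} [AddCommGroup X] [Module K X]
    (ξ η : MSeries K X X) (s : ℕ) (x : X) : X :=
  dcomp ξ η s x - dcomp η ξ s x

/-- The pointwise bracket on `A[[Y]]` (component functions) induced by the bracket of
the Lie algebra `A` : `[f,g]_s (y) = Σ_{n+r=s} [f_n(y), g_r(y)]`. -/
def PBr {Y A : Type*} [LieRing A] (f g : ℕ → Y → A) (s : ℕ) (y : Y) : A :=
  ∑ n ∈ Finset.range (s + 1), ⁅f n y, g (s - n) y⁆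

/-- Components of the fundamental action of a Lie algebra `B` on itself:
`d_b` has degree-`n` component `y ↦ t_n (ad y)^n (b)`. -/
def fd {K : Type*} [Field K] {B : Type*} [LieRing B] [LieAlgebra K B]
    (t : ℕ → K) (b : B) : ℕ → B → B :=
  fun n y => t n • ((LieAlgebra.ad K B y ^ n) b)

/-- The generating-series condition `Σ t_n T^n = T e^T / (e^T - 1)`, i.e.
`(Σ t_n T^n) (e^T - 1) = T e^T`. -/
def GenFun (K : Type*) [Field K] [CharZero K] (t : ℕ → K) : Prop :=
  PowerSeries.mk t * (PowerSeries.exp K - 1) = PowerSeries.X * PowerSeries.exp K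

section Helpers

variable {K : Type*} [Field K] {X F : Type*} [AddCommGroup X] [Module K X]
    [AddCommGroup F] [Module K F]

/-- Polynomial curves. -/
def IsPolyCurve (K : Type*) [Field K] {F : Type*} [AddCommGroup F] [Module K F] (γ : K → F) : Prop :=
  ∃ c : ℕ →₀ F, ∀ t, γ t = c.sum fun k v => t ^ k • v

lemma IsPolyCurve.mono (k : ℕ) (v : F) : IsPolyCurve K (fun t : K => t ^ k • v) :=
  ⟨Finsupp.single k v, fun t => by rw [Finsupp.sum_single_index]; simp⟩

lemma IsPolyCurve.const (v : F) : IsPolyCurve K (fun _ : K => v) := by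
  simpa using IsPolyCurve.mono (K := K) 0 v

lemma IsPolyCurve.add {γ δ : K → F} (h : IsPolyCurve K γ) (h' : IsPolyCurve K δ) :
    IsPolyCurve K (fun t => γ t + δ t) := by
  obtain ⟨c, hc⟩ := h
  obtain ⟨d, hd⟩ := h'
  refine ⟨c + d, fun t => ?_⟩
  beta_reduce
  rw [Finsupp.sum_add_index', hc, hd]
  · simp
  · intros; simp

lemma IsPolyCurve.sum {ι : Type*} (s : Finset ι) {γ : ι → K → F} (h : ∀ i ∈ s, IsPolyCurve K (γ i)) :
    IsPolyCurve K (fun t => ∑ i ∈ s, γ i t) := by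
  classical
  induction s using Finset.induction_on with
  | empty => simpa using IsPolyCurve.const (K := K) (0 : F)
  | insert a s ha ih =>
    simp only [Finset.sum_insert ha]
    exact (h a (by simp)).add (ih fun i hi => h i (by simp [hi]))

lemma IsPolyCurve.multilinear {m : ℕ} (u : MultilinearMap K (fun _ : Fin m => X) F)
    {γ : Fin m → K → X} (h : ∀ i, IsPolyCurve K (γ i)) : IsPolyCurve K (fun t => u fun i => γ i t) := by
  classical
  choose c hc using h
  have : (fun t => u fun i => γ i t) = fun t => ∑ r ∈ Fintype.piFinset (fun i => (c i).support),
      t ^ (∑ i, r i) • u (fun i => c i (r i)) := by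
    funext t
    simp only [hc, Finsupp.sum]
    rw [MultilinearMap.map_sum_finset]
    refine Finset.sum_congr rfl fun r _ => ?_
    rw [MultilinearMap.map_smul_univ u (fun i => t ^ r i), Finset.prod_pow_eq_pow_sum]
  rw [this]
  exact IsPolyCurve.sum _ fun r _ => IsPolyCurve.mono _ _

lemma IsPolyCurve.smul_pow {γ : K → F} (k : ℕ) (h : IsPolyCurve K γ) : IsPolyCurve K (fun t => t ^ k • γ t) := by
  obtain ⟨c, hc⟩ := h
  have : (fun t => t ^ k • γ t) = fun t => ∑ j ∈ c.support, t ^ (k + j) • c j := by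
    funext t
    rw [hc, Finsupp.sum, Finset.smul_sum]
    simp only [smul_smul, pow_add]
  rw [this]
  exact IsPolyCurve.sum _ fun r _ => IsPolyCurve.mono _ _

lemma IsPolyCurve.eq_zero [CharZero K] {γ : K → F} (h : IsPolyCurve K γ) (h0 : ∀ t, t • γ t = 0) :
    γ 0 = 0 := by
  obtain ⟨c, hc⟩ := h
  rw [← Module.forall_dual_apply_eq_zero_iff K]
  intro ℓ
  let p : Polynomial K := ∑ k ∈ c.support, Polynomial.monomial k (ℓ (c k))
  have hp : ∀ t, p.eval t = ℓ (γ t) := by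
    intro t
    simp only [p, hc, Finsupp.sum, Polynomial.eval_finset_sum, map_sum, map_smul,
      Polynomial.eval_monomial, smul_eq_mul, mul_comm]
  have : Polynomial.X * p = 0 := by
    apply Polynomial.funext
    intro t
    rw [Polynomial.eval_mul, hp, Polynomial.eval_X, ← smul_eq_mul, ← map_smul, h0]
    simp
  have hp0 : p = 0 := by simpa using this
  rw [← hp, hp0, Polynomial.eval_zero]

/-- Formal derivative at `0` of a polynomial curve. -/
def HasCurveD (K : Type*) [Field K] {F : Type*} [AddCommGroup F] [Module K F] (γ : K → F) (d : F) :
    Prop :=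
  ∃ δ : K → F, IsPolyCurve K δ ∧ δ 0 = d ∧ ∀ t, γ t = γ 0 + t • δ t

lemma HasCurveD.unique [CharZero K] {γ : K → F} {d e : F} (h : HasCurveD K γ d) (h' : HasCurveD K γ e) :
    d = e := by
  obtain ⟨δ, hδ, rfl, h1⟩ := h
  obtain ⟨ε, hε, rfl, h2⟩ := h'
  have hn : IsPolyCurve K (fun t => δ t + (-1 : K) • ε t) := by
    refine hδ.add ?_
    obtain ⟨c, hc⟩ := hε
    have : (fun t => (-1 : K) • ε t) = fun t => ∑ j ∈ c.support, t ^ j • ((-1 : K) • c j) := by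
      funext t
      rw [hc, Finsupp.sum, Finset.smul_sum]
      simp only [smul_smul, mul_comm]
    rw [this]
    exact IsPolyCurve.sum _ fun r _ => IsPolyCurve.mono _ _
  have := hn.eq_zero (fun t => by
    have h3 := (h1 t).symm.trans (h2 t)
    have h4 := add_left_cancel h3
    rw [smul_add, h4, smul_comm]
    simp)
  simpa [add_neg_eq_zero] using this

lemma HasCurveD.line (x v : X) : HasCurveD K (fun t : K => x + t • v) v :=
  ⟨fun _ => v, IsPolyCurve.const v, rfl, by simp⟩

lemma HasCurveD.sum {ι : Type*} (s : Finset ι) {γ : ι → K → F} {d : ι → F}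
    (h : ∀ i ∈ s, HasCurveD K (γ i) (d i)) :
    HasCurveD K (fun t => ∑ i ∈ s, γ i t) (∑ i ∈ s, d i) := by
  choose! δ h1 h2 h3 using h
  refine ⟨fun t => ∑ i ∈ s, δ i t, IsPolyCurve.sum s h1, Finset.sum_congr rfl h2, fun t => ?_⟩
  simp only [Finset.smul_sum, ← Finset.sum_add_distrib]
  exact Finset.sum_congr rfl fun i hi => h3 i hi t

lemma HasCurveD.multilinear {m : ℕ} (u : MultilinearMap K (fun _ : Fin m => X) F)
    {γ : Fin m → K → X} {d : Fin m → X} (h : ∀ i, HasCurveD K (γ i) (d i)) :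
    HasCurveD K (fun t => u fun i => γ i t)
      (∑ i, u (Function.update (fun i => γ i 0) i (d i))) := by
  classical
  choose δ h1 h2 h3 using h
  refine ⟨fun t => (∑ i, u (Function.update (fun i => γ i 0) i (δ i t))) +
    t ^ 1 • ∑ s ∈ Finset.univ.powerset.filter (fun s : Finset (Fin m) => 2 ≤ s.card),
      t ^ (s.card - 2) • u (s.piecewise (fun i => δ i t) (fun i => γ i 0)), ?_, ?_, ?_⟩
  · refine IsPolyCurve.add (IsPolyCurve.sum _ fun i _ => ?_) (IsPolyCurve.smul_pow _ (IsPolyCurve.sum _ fun s _ =>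
      IsPolyCurve.smul_pow _ ?_))
    · have := IsPolyCurve.multilinear u (γ := fun j t => Function.update (fun i => γ i 0) i (δ i t) j)
        (fun j => by
          by_cases hj : j = i
          · subst hj; simpa using h1 j
          · simpa [hj] using IsPolyCurve.const (K := K) (γ j 0))
      exact this
    · have := IsPolyCurve.multilinear u
        (γ := fun j t => s.piecewise (fun i => δ i t) (fun i => γ i 0) j)
        (fun j => by
          by_cases hj : j ∈ s
          · simpa [hj] using h1 j
          · simpa [hj] using IsPolyCurve.const (K := K) (γ j 0))
      exact this
  · simp [h2]
  · intro t
    have e : (fun i => γ i t) = (fun i => γ i 0) + (t • fun i => δ i t) := by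
      funext i; exact h3 i t
    beta_reduce
    rw [e, MultilinearMap.map_add_eq_map_add_linearDeriv_add, map_smul,
      MultilinearMap.linearDeriv_apply, smul_add, add_assoc]
    congr 2
    rw [Finset.smul_sum, Finset.smul_sum]
    refine Finset.sum_congr rfl fun s hs => ?_
    have hs2 : 2 ≤ s.card := by simpa using hs
    have : s.piecewise (t • fun i => δ i t) (fun i => γ i 0) =
        s.piecewise (fun i => t • s.piecewise (fun i => δ i t) (fun i => γ i 0) i)
          (s.piecewise (fun i => δ i t) (fun i => γ i 0)) := by
      funext i
      by_cases hi : i ∈ s <;> simp [hi]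
    rw [this, MultilinearMap.map_piecewise_smul u (fun _ => t), Finset.prod_const, smul_smul,
      smul_smul]
    congr 1
    rw [pow_one, ← pow_two, ← pow_add]
    congr 1
    omega

/-- First derivative. -/
def D1 {m : ℕ} (u : MultilinearMap K (fun _ : Fin m => X) F) (x v : X) : F :=
  ∑ i, u (Function.update (fun _ => x) i v)

/-- Second derivative. -/
def D2 {m : ℕ} (u : MultilinearMap K (fun _ : Fin m => X) F) (x v w : X) : F :=
  ∑ i, ∑ j, if j = i then 0 else u (Function.update (Function.update (fun _ => x) i v) j w)

lemma D2_symm {m : ℕ} (u : MultilinearMap K (fun _ : Fin m => X) F) (x v w : X) :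
    D2 u x v w = D2 u x w v := by
  unfold D2
  rw [Finset.sum_comm]
  refine Finset.sum_congr rfl fun i _ => Finset.sum_congr rfl fun j _ => ?_
  by_cases h : i = j
  · simp [h]
  · rw [if_neg h, if_neg (Ne.symm h), Function.update_comm h]

lemma D1_sum {m : ℕ} (u : MultilinearMap K (fun _ : Fin m => X) F) (x : X) {ι : Type*}
    (s : Finset ι) (v : ι → X) : D1 u x (∑ i ∈ s, v i) = ∑ i ∈ s, D1 u x (v i) := by
  unfold D1
  rw [Finset.sum_comm]
  exact Finset.sum_congr rfl fun i _ => MultilinearMap.map_update_sum u s i v _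

lemma D1_sub {m : ℕ} (u : MultilinearMap K (fun _ : Fin m => X) F) (x v w : X) :
    D1 u x (v - w) = D1 u x v - D1 u x w := by
  unfold D1
  rw [← Finset.sum_sub_distrib]
  exact Finset.sum_congr rfl fun i _ => MultilinearMap.map_update_sub u _ i v w

lemma D1_zero {m : ℕ} (u : MultilinearMap K (fun _ : Fin m => X) F) (x : X) :
    D1 u x 0 = 0 := by
  simpa using D1_sub u x 0 0

lemma hasCurveD_diag {m : ℕ} (u : MultilinearMap K (fun _ : Fin m => X) F) (x v : X) :
    HasCurveD K (fun t : K => u fun _ => x + t • v) (D1 u x v) := by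
  have := HasCurveD.multilinear u (γ := fun _ t => x + t • v) (d := fun _ => v)
    (fun _ => HasCurveD.line x v)
  simpa [D1] using this

lemma hasCurveD_dcomp (η : MSeries K X X) (f : MSeries K X F) (s : ℕ) (x v : X) :
    HasCurveD K (fun t : K => dcomp η f s (x + t • v))
      (∑ q ∈ Finset.range (s + 2), (D1 (f (s + 1 - q)) x (D1 (η q) x v) +
        D2 (f (s + 1 - q)) x (η q fun _ => x) v)) := by
  unfold dcomp
  refine HasCurveD.sum _ fun q _ => ?_
  have key : ∀ i : Fin (s + 1 - q), HasCurveD K (fun t : K => f (s + 1 - q)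
      (Function.update (fun _ => x + t • v) i (η q fun _ => x + t • v)))
      (∑ j, f (s + 1 - q) (Function.update (Function.update (fun _ => x) i (η q fun _ => x)) j
        (if j = i then D1 (η q) x v else v))) := by
    intro i
    have := HasCurveD.multilinear (f (s + 1 - q))
      (γ := fun j t => Function.update (fun _ => x + t • v) i (η q fun _ => x + t • v) j)
      (d := fun j => if j = i then D1 (η q) x v else v) (fun j => by
        by_cases hj : j = i
        · subst hj; simpa using hasCurveD_diag (η q) x v
        · simpa [hj] using HasCurveD.line (K := K) x v)
    simpa using this
  have h2 := HasCurveD.sum Finset.univ (fun i _ => key i)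
  convert h2 using 1
  unfold D2
  conv_lhs => rw [D1]
  rw [← Finset.sum_add_distrib]
  refine Finset.sum_congr rfl fun i _ => ?_
  rw [← Finset.add_sum_erase _ _ (Finset.mem_univ i),
    ← Finset.add_sum_erase _ _ (Finset.mem_univ i)]
  simp only [if_true, zero_add, Function.update_idem]
  congr 1
  refine Finset.sum_congr rfl fun j hj => ?_
  rw [if_neg (Finset.ne_of_mem_erase hj), if_neg (Finset.ne_of_mem_erase hj)]

lemma dcomp_eq (η : MSeries K X X) (f : MSeries K X F) (s : ℕ) (x : X) :
    dcomp η f s x = ∑ r ∈ Finset.range (s + 2), D1 (f (s + 1 - r)) x (η r fun _ => x) := rfl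

lemma dcomp_dcomp [CharZero K] (ξ η : MSeries K X X) (f g : MSeries K X F)
    (hg : ∀ s x, evalS g s x = dcomp η f s x) (s : ℕ) (x : X) :
    dcomp ξ g s x = (∑ r ∈ Finset.range (s + 2), ∑ q ∈ Finset.range (s + 1 - r + 2),
        D1 (f (s + 1 - r + 1 - q)) x (D1 (η q) x (ξ r fun _ => x))) +
      ∑ r ∈ Finset.range (s + 2), ∑ q ∈ Finset.range (s + 1 - r + 2),
        D2 (f (s + 1 - r + 1 - q)) x (η q fun _ => x) (ξ r fun _ => x) := by
  rw [dcomp_eq, ← Finset.sum_add_distrib]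
  refine Finset.sum_congr rfl fun r _ => ?_
  rw [← Finset.sum_add_distrib]
  refine HasCurveD.unique (hasCurveD_diag (K := K) (g (s + 1 - r)) x (ξ r fun _ => x)) ?_
  have := hasCurveD_dcomp (K := K) η f (s + 1 - r) x (ξ r fun _ => x)
  simp only [← hg] at this
  exact this

lemma reindex1 (G : ℕ → ℕ → ℕ → F) (hG : ∀ n r, G n 0 r = 0) (s : ℕ) :
    ∑ p ∈ Finset.range (s + 2), ∑ r ∈ Finset.range (p + 2), G (s + 1 - p) (p + 1 - r) r =
    ∑ r ∈ Finset.range (s + 2), ∑ q ∈ Finset.range (s + 1 - r + 2), G (s + 1 - r + 1 - q) q r := by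
  have h1 : ∀ p, ∑ r ∈ Finset.range (p + 2), G (s + 1 - p) (p + 1 - r) r =
      ∑ r ∈ Finset.range (p + 1), G (s + 1 - p) (p + 1 - r) r := by
    intro p
    rw [Finset.sum_range_succ]; simp [hG]
  have h2 : ∀ r, ∑ q ∈ Finset.range (s + 1 - r + 2), G (s + 1 - r + 1 - q) q r =
      ∑ q ∈ Finset.range (s + 1 - r + 1), G (s + 1 - r - q) (q + 1) r := by
    intro r
    rw [Finset.sum_range_succ']; simp [hG]
  simp only [h1, h2]
  rw [Finset.sum_sigma', Finset.sum_sigma']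
  refine Finset.sum_nbij' (fun a => ⟨a.2, a.1 - a.2⟩) (fun b => ⟨b.1 + b.2, b.1⟩) ?_ ?_ ?_ ?_ ?_
  · rintro ⟨p, r⟩ h; simp only [Finset.mem_sigma, Finset.mem_range] at h ⊢; omega
  · rintro ⟨r, q⟩ h; simp only [Finset.mem_sigma, Finset.mem_range] at h ⊢; omega
  · rintro ⟨p, r⟩ h
    simp only [Finset.mem_sigma, Finset.mem_range] at h
    have : r + (p - r) = p := by omega
    simp [this]
  · rintro ⟨r, q⟩ h; simp
  · rintro ⟨p, r⟩ h
    simp only [Finset.mem_sigma, Finset.mem_range] at h ⊢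
    have e1 : s + 1 - r - (p - r) = s + 1 - p := by omega
    have e2 : p - r + 1 = p + 1 - r := by omega
    rw [e1, e2]

lemma reindex2 (H : ℕ → ℕ → ℕ → F) (hH : ∀ q r, H 0 q r = 0) (s : ℕ) :
    ∑ r ∈ Finset.range (s + 2), ∑ q ∈ Finset.range (s + 1 - r + 2), H (s + 1 - r + 1 - q) q r =
    ∑ r ∈ Finset.range (s + 2), ∑ q ∈ Finset.range (s + 1 - r + 2), H (s + 1 - r + 1 - q) r q := by
  have h1 : ∀ r, ∑ q ∈ Finset.range (s + 1 - r + 2), H (s + 1 - r + 1 - q) q r =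
      ∑ q ∈ Finset.range (s + 1 - r + 1), H (s + 1 - r + 1 - q) q r := by
    intro p
    rw [Finset.sum_range_succ]; simp [hH]
  have h2 : ∀ r, ∑ q ∈ Finset.range (s + 1 - r + 2), H (s + 1 - r + 1 - q) r q =
      ∑ q ∈ Finset.range (s + 1 - r + 1), H (s + 1 - r + 1 - q) r q := by
    intro p
    rw [Finset.sum_range_succ]; simp [hH]
  simp only [h1, h2]
  rw [Finset.sum_comm' (t' := Finset.range (s + 2))
    (s' := fun q => Finset.range (s + 1 - q + 1))]
  · refine Finset.sum_congr rfl fun a ha => Finset.sum_congr rfl fun b hb => ?_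
    simp only [Finset.mem_range] at ha hb
    have e : s + 1 - b + 1 - a = s + 1 - a + 1 - b := by omega
    rw [e]
  · intro a b
    simp only [Finset.mem_range]
    omega

end Helpers

/-- `[ξ,η] f = ξ(η f) - η(ξ f)` : derivation of formal series makes
`F[[X]]` a module over the Lie algebra `S(X)` (the iterated derivatives being computed
through any multilinear presentations `θ` of `[ξ,η]`, `gEta` of `η f` and `gXi` of `ξ f`). -/
theorem stmt16 (K : Type*) [Field K] [CharZero K] (X F : Type*) [AddCommGroup X] [Module K X]
    [AddCommGroup F] [Module K F]
    (ξ η : MSeries K X X) (f : MSeries K X F)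
    (θ : MSeries K X X) (hθ : ∀ s x, evalS θ s x = br ξ η s x)
    (gEta : MSeries K X F) (hgEta : ∀ s x, evalS gEta s x = dcomp η f s x)
    (gXi : MSeries K X F) (hgXi : ∀ s x, evalS gXi s x = dcomp ξ f s x) :
    ∀ s x, dcomp θ f s x = dcomp ξ gEta s x - dcomp η gXi s x := by
  intro s x
  rw [dcomp_dcomp ξ η f gEta hgEta, dcomp_dcomp η ξ f gXi hgXi, dcomp_eq]
  have h1 : ∀ p, (θ p fun _ => x) = dcomp ξ η p x - dcomp η ξ p x := fun p => hθ p x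
  simp only [h1, D1_sub, Finset.sum_sub_distrib]
  simp only [dcomp_eq, D1_sum]
  have z : ∀ (ζ : MSeries K X X) (v : X), D1 (ζ 0) x v = 0 := fun ζ v => by simp [D1]
  rw [reindex1 (fun n q r => D1 (f n) x (D1 (η q) x (ξ r fun _ => x)))
      (fun n r => by simp only [z, D1_zero]),
    reindex1 (fun n q r => D1 (f n) x (D1 (ξ q) x (η r fun _ => x)))
      (fun n r => by simp only [z, D1_zero]),
    reindex2 (fun n q r => D2 (f n) x (η q fun _ => x) (ξ r fun _ => x))
      (fun q r => by simp [D2])]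
  simp only [D2_symm _ x (η _ fun _ => x)]
  abel
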